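/- With g as in the Saint Venant–Kirchhoff dual setting, there is a constant C > 0 such that g(A,a,B) ≤ C(|a|^{4/3} + |A|^{4/3} + |B|⁴ + 1) for all (A,a,B). In particular g is finite everywhere. -/

import Mathlib

open Matrix

noncomputable def frob {d : ℕ} (F : Matrix (Fin d) (Fin d) ℝ) : ℝ :=
  Real.sqrt (∑ i, ∑ j, (F i j) ^ 2)

noncomputable def mdot {d : ℕ} (A B : Matrix (Fin d) (Fin d) ℝ) : ℝ :=
  ∑ i, ∑ j, A i j * B i j

/-- The Saint Venant–Kirchhoff first Piola–Kirchhoff stress. -/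
noncomputable def svkP (G L : ℝ) {d : ℕ} (F : Matrix (Fin d) (Fin d) ℝ) :
    Matrix (Fin d) (Fin d) ℝ :=
  F * (G • (Fᵀ * F) + ((L / 2) * frob F ^ 2) • (1 : Matrix (Fin d) (Fin d) ℝ)
    - (G + L * d / 2) • (1 : Matrix (Fin d) (Fin d) ℝ))

/-- The auxiliary potential H(y,F). -/
noncomputable def svkH (G L : ℝ) {d : ℕ} (y : EuclideanSpace ℝ (Fin d))
    (F : Matrix (Fin d) (Fin d) ℝ) : ℝ :=
  (1/4) * ‖y‖ ^ 4 + ((G + L / 2) / 2) * frob (Fᵀ * F) ^ 2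

/-- The set over which the dual integrand g(A,a,B) is a supremum. -/
noncomputable def svkSet (G L : ℝ) {d : ℕ} (A : Matrix (Fin d) (Fin d) ℝ)
    (a : EuclideanSpace ℝ (Fin d)) (B : Matrix (Fin d) (Fin d) ℝ) : Set ℝ :=
  { z | ∃ (F : Matrix (Fin d) (Fin d) ℝ) (y : EuclideanSpace ℝ (Fin d)),
      z = (∑ i, a i * y i) + mdot A F + mdot B (svkP G L F) - svkH G L y F }

lemma frob_nonneg {d : ℕ} (F : Matrix (Fin d) (Fin d) ℝ) : 0 ≤ frob F :=
  Real.sqrt_nonneg _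

lemma frob_sq {d : ℕ} (F : Matrix (Fin d) (Fin d) ℝ) :
    frob F ^ 2 = ∑ i, ∑ j, (F i j) ^ 2 :=
  Real.sq_sqrt (Finset.sum_nonneg fun _ _ => Finset.sum_nonneg fun _ _ => sq_nonneg _)

section
open scoped Matrix.Norms.Frobenius

lemma frob_eq_norm {d : ℕ} (F : Matrix (Fin d) (Fin d) ℝ) : frob F = ‖F‖ := by
  rw [Matrix.frobenius_norm_def, frob, Real.sqrt_eq_rpow]
  simp

lemma frob_mul_le {d : ℕ} (A B : Matrix (Fin d) (Fin d) ℝ) :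
    frob (A * B) ≤ frob A * frob B := by
  simpa only [frob_eq_norm] using Matrix.frobenius_norm_mul A B

end

lemma frob_transpose {d : ℕ} (F : Matrix (Fin d) (Fin d) ℝ) : frob Fᵀ = frob F := by
  simp only [frob, Matrix.transpose_apply]
  rw [Finset.sum_comm]

lemma frob_one_sq (d : ℕ) : frob (1 : Matrix (Fin d) (Fin d) ℝ) ^ 2 = d := by
  simp [frob_sq, Matrix.one_apply]

lemma frob_neg {d : ℕ} (F : Matrix (Fin d) (Fin d) ℝ) : frob (-F) = frob F := by
  simp [frob]

lemma mdot_le {d : ℕ} (A B : Matrix (Fin d) (Fin d) ℝ) :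
    mdot A B ≤ frob A * frob B := by
  have h := Real.sum_mul_le_sqrt_mul_sqrt (Finset.univ : Finset (Fin d × Fin d))
    (fun p => A p.1 p.2) (fun p => B p.1 p.2)
  simpa only [Fintype.sum_prod_type, mdot, frob] using h

lemma abs_mdot_le {d : ℕ} (A B : Matrix (Fin d) (Fin d) ℝ) :
    |mdot A B| ≤ frob A * frob B := by
  refine abs_le.2 ⟨?_, mdot_le A B⟩
  have h := mdot_le A (-B)
  have hneg : mdot A (-B) = -mdot A B := by simp [mdot]
  rw [frob_neg, hneg] at h
  linarith

lemma mdot_transpose_mul_self_one {d : ℕ} (F : Matrix (Fin d) (Fin d) ℝ) :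
    mdot (Fᵀ * F) 1 = frob F ^ 2 := by
  rw [frob_sq, Finset.sum_comm]
  simp [mdot, Matrix.one_apply, Matrix.mul_apply, sq]

lemma frob_pow_four_le {d : ℕ} (F : Matrix (Fin d) (Fin d) ℝ) :
    frob F ^ 4 ≤ d * frob (Fᵀ * F) ^ 2 := by
  have h := mdot_le (Fᵀ * F) 1
  rw [mdot_transpose_mul_self_one] at h
  calc frob F ^ 4 = (frob F ^ 2) ^ 2 := by ring
    _ ≤ (frob (Fᵀ * F) * frob (1 : Matrix (Fin d) (Fin d) ℝ)) ^ 2 :=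
        pow_le_pow_left₀ (sq_nonneg _) h 2
    _ = d * frob (Fᵀ * F) ^ 2 := by rw [mul_pow, frob_one_sq]; ring

lemma frob_mul_transpose_mul_self_le {d : ℕ} (F : Matrix (Fin d) (Fin d) ℝ) :
    frob (F * (Fᵀ * F)) ≤ frob F ^ 3 := by
  have h := frob_mul_le Fᵀ F
  rw [frob_transpose] at h
  calc frob (F * (Fᵀ * F)) ≤ frob F * frob (Fᵀ * F) := frob_mul_le _ _
    _ ≤ frob F * (frob F * frob F) := mul_le_mul_of_nonneg_left h (frob_nonneg F)
    _ = frob F ^ 3 := by ring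

lemma mdot_svkP (G L : ℝ) {d : ℕ} (B F : Matrix (Fin d) (Fin d) ℝ) :
    mdot B (svkP G L F) = G * mdot B (F * (Fᵀ * F))
      + L / 2 * frob F ^ 2 * mdot B F - (G + L * d / 2) * mdot B F := by
  have h : svkP G L F = G • (F * (Fᵀ * F)) + (L / 2 * frob F ^ 2) • F
      - (G + L * d / 2) • F := by
    simp [svkP, mul_add, mul_sub]
  rw [h]
  simp only [mdot, Matrix.sub_apply, Matrix.add_apply, Matrix.smul_apply, smul_eq_mul,
    Finset.mul_sum, ← Finset.sum_add_distrib, ← Finset.sum_sub_distrib]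
  refine Finset.sum_congr rfl fun i _ => Finset.sum_congr rfl fun j _ => ?_
  ring

lemma mdot_svkP_le (G L : ℝ) {d : ℕ} (hG : 0 < G) (B F : Matrix (Fin d) (Fin d) ℝ) :
    mdot B (svkP G L F) ≤
      frob B * ((G + |L| / 2) * frob F ^ 3 + |G + L * d / 2| * frob F) := by
  have hBF := abs_mdot_le B F
  have hcubic : G * mdot B (F * (Fᵀ * F)) ≤ G * (frob B * frob F ^ 3) :=
    mul_le_mul_of_nonneg_left ((mdot_le _ _).trans
      (mul_le_mul_of_nonneg_left (frob_mul_transpose_mul_self_le F) (frob_nonneg B))) hG.le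
  have hvol : L / 2 * frob F ^ 2 * mdot B F ≤ |L| / 2 * frob F ^ 2 * (frob B * frob F) := by
    refine (le_abs_self _).trans ?_
    rw [abs_mul, abs_mul, abs_div, abs_two, abs_of_nonneg (sq_nonneg (frob F))]
    gcongr
  have hlin : -((G + L * d / 2) * mdot B F) ≤ |G + L * d / 2| * (frob B * frob F) := by
    refine (neg_le_abs _).trans ?_
    rw [abs_mul]
    gcongr
  rw [mdot_svkP]
  linarith

lemma exists_coercivity_svkH {d : ℕ} {G L : ℝ} (hG : 0 < G) (hGL : 0 < G + d * L / 2) :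
    ∃ c : ℝ, 0 < c ∧ ∀ (y : EuclideanSpace ℝ (Fin d)) (F : Matrix (Fin d) (Fin d) ℝ),
      (1 / 4) * ‖y‖ ^ 4 + c * frob F ^ 4 ≤ svkH G L y F := by
  rcases Nat.eq_zero_or_pos d with rfl | hd
  · exact ⟨1, one_pos, fun y F => by simp [svkH, frob]⟩
  have hd' : (1 : ℝ) ≤ d := by exact_mod_cast hd
  have hGL' : 0 < G + L / 2 := by
    rcases le_total 0 L with hL | hL
    · linarith
    · nlinarith
  refine ⟨(G + L / 2) / 2 / d, by positivity, fun y F => ?_⟩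
  have h : (G + L / 2) / 2 / d * frob F ^ 4 ≤ (G + L / 2) / 2 * frob (Fᵀ * F) ^ 2 := by
    rw [div_mul_eq_mul_div, div_le_iff₀ (by positivity), mul_assoc,
      mul_comm (frob (Fᵀ * F) ^ 2)]
    exact mul_le_mul_of_nonneg_left (frob_pow_four_le F) (by positivity)
  unfold svkH
  linarith

lemma exists_pow_three_mul_le_left {ε : ℝ} (hε : 0 < ε) :
    ∃ C : ℝ, 0 < C ∧ ∀ u t : ℝ, 0 ≤ u → 0 ≤ t → u ^ 3 * t ≤ ε * u ^ 4 + C * t ^ 4 := by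
  refine ⟨(1 / ε) ^ 3, by positivity, fun u t hu ht => ?_⟩
  rcases le_total t (ε * u) with h | h
  · calc u ^ 3 * t ≤ u ^ 3 * (ε * u) := by gcongr
      _ = ε * u ^ 4 := by ring
      _ ≤ _ := le_add_of_nonneg_right (by positivity)
  · have h' : u ≤ 1 / ε * t := by
      rw [one_div_mul_eq_div, le_div_iff₀ hε]
      linarith
    calc u ^ 3 * t ≤ (1 / ε * t) ^ 3 * t := by gcongr
      _ = (1 / ε) ^ 3 * t ^ 4 := by ring
      _ ≤ _ := le_add_of_nonneg_left (by positivity)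

lemma exists_pow_three_mul_le_right {ε : ℝ} (hε : 0 < ε) :
    ∃ C : ℝ, 0 < C ∧ ∀ u t : ℝ, 0 ≤ u → 0 ≤ t → u ^ 3 * t ≤ ε * t ^ 4 + C * u ^ 4 := by
  have hδ : 0 < min ε 1 := lt_min hε one_pos
  have hδε : min ε 1 ^ 3 ≤ ε :=
    (pow_le_of_le_one hδ.le (min_le_right _ _) three_ne_zero).trans (min_le_left _ _)
  refine ⟨1 / min ε 1, by positivity, fun u t hu ht => ?_⟩
  rcases le_total u (min ε 1 * t) with h | h
  · calc u ^ 3 * t ≤ (min ε 1 * t) ^ 3 * t := by gcongr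
      _ = min ε 1 ^ 3 * t ^ 4 := by ring
      _ ≤ ε * t ^ 4 := by gcongr
      _ ≤ _ := le_add_of_nonneg_right (by positivity)
  · have h' : t ≤ 1 / min ε 1 * u := by
      rw [one_div_mul_eq_div, le_div_iff₀ hδ]
      linarith
    calc u ^ 3 * t ≤ u ^ 3 * (1 / min ε 1 * u) := by gcongr
      _ = 1 / min ε 1 * u ^ 4 := by ring
      _ ≤ _ := le_add_of_nonneg_left (by positivity)

lemma exists_mul_le_rpow_four_thirds {ε : ℝ} (hε : 0 < ε) :
    ∃ C : ℝ, 0 < C ∧ ∀ s t : ℝ, 0 ≤ s → 0 ≤ t →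
      s * t ≤ ε * t ^ 4 + C * s ^ ((4 : ℝ) / 3) := by
  obtain ⟨C, hC, h⟩ := exists_pow_three_mul_le_right hε
  refine ⟨C, hC, fun s t hs ht => ?_⟩
  have h' := h (s ^ ((1 : ℝ) / 3)) t (by positivity) ht
  have h3 : (s ^ ((1 : ℝ) / 3)) ^ 3 = s := by
    rw [← Real.rpow_mul_natCast hs]; norm_num
  have h4 : (s ^ ((1 : ℝ) / 3)) ^ 4 = s ^ ((4 : ℝ) / 3) := by
    rw [← Real.rpow_mul_natCast hs]; norm_num
  rwa [h3, h4] at h'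

theorem svk_dual_integrand_upper_bound (d : ℕ) (G L : ℝ)
    (hG : 0 < G) (hGL : 0 < G + d * L / 2) :
    ∃ C : ℝ, 0 < C ∧
      ∀ (A B : Matrix (Fin d) (Fin d) ℝ) (a : EuclideanSpace ℝ (Fin d)),
        BddAbove (svkSet G L A a B) ∧
        sSup (svkSet G L A a B)
          ≤ C * (‖a‖ ^ ((4:ℝ)/3) + frob A ^ ((4:ℝ)/3) + frob B ^ 4 + 1) := by
  obtain ⟨c, hc, hH⟩ := exists_coercivity_svkH hG hGL
  obtain ⟨Ca, hCa, ha⟩ := exists_mul_le_rpow_four_thirds (ε := 1 / 4) (by norm_num)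
  obtain ⟨CA, hCA, hA⟩ := exists_mul_le_rpow_four_thirds (ε := c / 2) (by positivity)
  set K₁ := G + |L| / 2
  set K₂ := |G + L * d / 2|
  have hK₁pos : 0 < K₁ := by positivity
  have hK₂nonneg : 0 ≤ K₂ := abs_nonneg _
  have hK : 0 < K₁ + K₂ := by positivity
  obtain ⟨CB, hCB, hB⟩ :=
    exists_pow_three_mul_le_left (ε := c / 2 / (K₁ + K₂)) (by positivity)
  refine ⟨Ca + CA + ((K₁ + K₂) * CB + K₂), by positivity, fun A B a => ?_⟩
  have key : ∀ z ∈ svkSet G L A a B, z ≤ (Ca + CA + ((K₁ + K₂) * CB + K₂)) *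
      (‖a‖ ^ ((4:ℝ)/3) + frob A ^ ((4:ℝ)/3) + frob B ^ 4 + 1) := by
    rintro z ⟨F, y, rfl⟩
    have hay : ∑ i, a i * y i ≤ ‖a‖ * ‖y‖ := by
      have h := real_inner_le_norm y a
      rw [PiLp.inner_apply] at h
      simpa [mul_comm] using h
    have hf := frob_nonneg F
    have hb := frob_nonneg B
    have hf3 : frob F ≤ frob F ^ 3 + 1 := by
      nlinarith [mul_nonneg (add_nonneg hf zero_le_one) (sq_nonneg (frob F - 1))]
    have hb4 : frob B ≤ frob B ^ 4 + 1 := by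
      nlinarith [sq_nonneg (frob B ^ 2 - 1), sq_nonneg (frob B - 1)]
    have hBP : mdot B (svkP G L F) ≤
        c / 2 * frob F ^ 4 + ((K₁ + K₂) * CB + K₂) * (frob B ^ 4 + 1) := by
      calc mdot B (svkP G L F) ≤ frob B * (K₁ * frob F ^ 3 + K₂ * frob F) :=
            mdot_svkP_le G L hG B F
        _ ≤ frob B * (K₁ * frob F ^ 3 + K₂ * (frob F ^ 3 + 1)) := by gcongr
        _ = (K₁ + K₂) * (frob F ^ 3 * frob B) + K₂ * frob B := by ring
        _ ≤ (K₁ + K₂) * (c / 2 / (K₁ + K₂) * frob F ^ 4 + CB * frob B ^ 4)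
            + K₂ * (frob B ^ 4 + 1) := by
          gcongr
          exact hB _ _ hf hb
        _ = c / 2 * frob F ^ 4 + ((K₁ + K₂) * CB * frob B ^ 4 + K₂ * (frob B ^ 4 + 1)) := by
          field_simp
          ring
        _ ≤ _ := by
          have : 0 ≤ (K₁ + K₂) * CB := by positivity
          linarith
    have hy := ha ‖a‖ ‖y‖ (norm_nonneg _) (norm_nonneg _)
    have hAF := (mdot_le A F).trans (hA _ _ (frob_nonneg A) hf)
    have hcoer := hH y F
    have hpa : 0 ≤ ‖a‖ ^ ((4:ℝ)/3) := by positivity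
    have hpA : 0 ≤ frob A ^ ((4:ℝ)/3) := Real.rpow_nonneg (frob_nonneg A) _
    have hpB : 0 ≤ frob B ^ 4 := by positivity
    have hD : 0 ≤ (K₁ + K₂) * CB + K₂ := by positivity
    have hbound : (∑ i, a i * y i) + mdot A F + mdot B (svkP G L F) - svkH G L y F ≤
        Ca * ‖a‖ ^ ((4:ℝ)/3) + CA * frob A ^ ((4:ℝ)/3)
          + ((K₁ + K₂) * CB + K₂) * (frob B ^ 4 + 1) := by
      linarith
    have h₁ := mul_le_mul_of_nonneg_left
      (show ‖a‖ ^ ((4:ℝ)/3) ≤ ‖a‖ ^ ((4:ℝ)/3) + frob A ^ ((4:ℝ)/3) + frob B ^ 4 + 1 by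
        linarith) hCa.le
    have h₂ := mul_le_mul_of_nonneg_left
      (show frob A ^ ((4:ℝ)/3) ≤ ‖a‖ ^ ((4:ℝ)/3) + frob A ^ ((4:ℝ)/3) + frob B ^ 4 + 1 by
        linarith) hCA.le
    have h₃ := mul_le_mul_of_nonneg_left
      (show frob B ^ 4 + 1 ≤ ‖a‖ ^ ((4:ℝ)/3) + frob A ^ ((4:ℝ)/3) + frob B ^ 4 + 1 by
        linarith) hD
    rw [add_mul, add_mul]
    linarith
  exact ⟨⟨_, key⟩, csSup_le ⟨_, 0, 0, rfl⟩ key⟩
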